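/- arXiv:1910.07483 — 5 statements merged into one kernel-verified Lean document; each statement's English description precedes it below -/
import Mathlib

section
/- Let a, b, R be positive reals and let δ be a real with 0 < δ ≤ b·R. Then the minimum of f(x₁,x₂,x₃) = a·(x₁ − R)² + b·x₂² + (x₃ − (R+δ))² over the region M1 = {(x₁,x₂,x₃) ∈ ℝ³ : x₃ ≤ x₂ ≤ x₁} equals b·(R+δ)²/(b+1), and it is attained at the point (R, (R+δ)/(1+b), (R+δ)/(1+b)). -/
theorem mul_sq_div_le_of_le {b s y z : ℝ} (hb : 0 < b) (hs : 0 ≤ s) (hzy : z ≤ y) :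
    b * s ^ 2 / (b + 1) ≤ b * y ^ 2 + (z - s) ^ 2 := by
  rw [div_le_iff₀ (by positivity)]
  have hsq : s ^ 2 ≤ (y + (s - z)) ^ 2 := pow_le_pow_left₀ hs (by linarith) 2
  calc b * s ^ 2 ≤ b * (y + (s - z)) ^ 2 := by gcongr
    _ ≤ b * (y + (s - z)) ^ 2 + (b * y - (s - z)) ^ 2 := le_add_of_nonneg_right (sq_nonneg _)
    _ = (b * y ^ 2 + (z - s) ^ 2) * (b + 1) := by ring

/-- The minimum of `f(x₁,x₂,x₃) = a(x₁−R)² + bx₂² + (x₃−(R+δ))²` over the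
monotone-decreasing region `M1 = {x₃ ≤ x₂ ≤ x₁}` equals `b(R+δ)²/(b+1)`,
attained at `(R, (R+δ)/(1+b), (R+δ)/(1+b))`. -/
theorem qmix_M1_min (a b R δ : ℝ) (ha : 0 < a) (hb : 0 < b) (hR : 0 < R)
    (hδ : 0 < δ) (hδb : δ ≤ b * R)
    (f : ℝ × ℝ × ℝ → ℝ)
    (hf : f = fun p => a * (p.1 - R) ^ 2 + b * p.2.1 ^ 2 + (p.2.2 - (R + δ)) ^ 2)
    (M1 : Set (ℝ × ℝ × ℝ))
    (hM1 : M1 = {p : ℝ × ℝ × ℝ | p.2.2 ≤ p.2.1 ∧ p.2.1 ≤ p.1}) :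
    IsLeast (f '' M1) (b * (R + δ) ^ 2 / (b + 1)) ∧
    (R, (R + δ) / (1 + b), (R + δ) / (1 + b)) ∈ M1 ∧
    f (R, (R + δ) / (1 + b), (R + δ) / (1 + b)) = b * (R + δ) ^ 2 / (b + 1) := by
  subst hf hM1
  have hmem : (R, (R + δ) / (1 + b), (R + δ) / (1 + b)) ∈
      {p : ℝ × ℝ × ℝ | p.2.2 ≤ p.2.1 ∧ p.2.1 ≤ p.1} := by
    refine ⟨le_rfl, ?_⟩
    change (R + δ) / (1 + b) ≤ R
    rw [div_le_iff₀ (by positivity)]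
    linarith
  have hval : a * (R - R) ^ 2 + b * ((R + δ) / (1 + b)) ^ 2 +
      ((R + δ) / (1 + b) - (R + δ)) ^ 2 = b * (R + δ) ^ 2 / (b + 1) := by
    field_simp
    ring
  refine ⟨⟨⟨_, hmem, hval⟩, ?_⟩, hmem, hval⟩
  rintro _ ⟨⟨x, y, z⟩, ⟨hzy, -⟩, rfl⟩
  have key := mul_sq_div_le_of_le hb (add_pos hR hδ).le hzy
  have hx : 0 ≤ a * (x - R) ^ 2 := by positivity
  dsimp only
  linarith
end

section
/- Let a, b, R be positive reals and let δ > 0 be real. Then the minimum of f(x₁,x₂,x₃) = a·(x₁ − R)² + b·x₂² + (x₃ − (R+δ))² over the region M2 = {(x₁,x₂,x₃) ∈ ℝ³ : x₁ ≤ x₂ ≤ x₃} equals a·b·R²/(a+b), and it is attained at the point (a·R/(a+b), a·R/(a+b), R+δ). -/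
/-- The minimum of `f(x₁,x₂,x₃) = a(x₁−R)² + bx₂² + (x₃−(R+δ))²` over the
monotone-increasing region `M2 = {x₁ ≤ x₂ ≤ x₃}` equals `abR²/(a+b)`,
attained at `(aR/(a+b), aR/(a+b), R+δ)`. -/
theorem qmix_M2_min (a b R δ : ℝ) (ha : 0 < a) (hb : 0 < b) (hR : 0 < R)
    (hδ : 0 < δ)
    (f : ℝ × ℝ × ℝ → ℝ)
    (hf : f = fun p => a * (p.1 - R) ^ 2 + b * p.2.1 ^ 2 + (p.2.2 - (R + δ)) ^ 2)
    (M2 : Set (ℝ × ℝ × ℝ))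
    (hM2 : M2 = {p : ℝ × ℝ × ℝ | p.1 ≤ p.2.1 ∧ p.2.1 ≤ p.2.2}) :
    IsLeast (f '' M2) (a * b * R ^ 2 / (a + b)) ∧
    (a * R / (a + b), a * R / (a + b), R + δ) ∈ M2 ∧
    f (a * R / (a + b), a * R / (a + b), R + δ) = a * b * R ^ 2 / (a + b) := by
  have hab : 0 < a + b := add_pos ha hb
  have hmem : (a * R / (a + b), a * R / (a + b), R + δ) ∈ M2 := by
    subst hM2
    refine ⟨le_rfl, ?_⟩
    change a * R / (a + b) ≤ R + δ
    rw [div_le_iff₀ hab]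
    nlinarith [mul_pos hb hR, mul_pos hδ hab]
  have hval : f (a * R / (a + b), a * R / (a + b), R + δ) = a * b * R ^ 2 / (a + b) := by
    subst hf
    dsimp only
    field_simp
    ring
  refine ⟨⟨⟨_, hmem, hval⟩, ?_⟩, hmem, hval⟩
  rintro _ ⟨⟨x, y, z⟩, hp, rfl⟩
  subst hf hM2
  obtain ⟨hxy : x ≤ y, -⟩ := hp
  change a * b * R ^ 2 / (a + b) ≤ a * (x - R) ^ 2 + b * y ^ 2 + (z - (R + δ)) ^ 2
  -- `2abR / (a + b)` is the Lagrange multiplier of the active constraint `x ≤ y`.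
  have key : a * (x - R) ^ 2 + b * y ^ 2 - a * b * R ^ 2 / (a + b) =
      a * (x - a * R / (a + b)) ^ 2 + b * (y - a * R / (a + b)) ^ 2 +
        2 * a * b * R / (a + b) * (y - x) := by
    field_simp
    ring
  have hmul : 0 ≤ 2 * a * b * R / (a + b) * (y - x) :=
    mul_nonneg (by positivity) (sub_nonneg.mpr hxy)
  have hsq : 0 ≤ a * (x - a * R / (a + b)) ^ 2 + b * (y - a * R / (a + b)) ^ 2 := by
    positivity
  linarith [sq_nonneg (z - (R + δ))]
end

section
/- Let n ≥ 1 and k ≥ 3 be natural numbers, let b = Σ_{s=1}^{k−2} C(n+s−1, s) and a = kⁿ − (b+1) (viewed as positive reals), let R > 0, and let δ be a real with 0 < δ ≤ R·(√(a·(b+1)/(a+b)) − 1). Then the minimum of f(x₁,x₂,x₃) = a·(x₁ − R)² + b·x₂² + (x₃ − (R+δ))² over {(x₁,x₂,x₃) : x₃ ≤ x₂ ≤ x₁} is less than or equal to its minimum over {(x₁,x₂,x₃) : x₁ ≤ x₂ ≤ x₃}. -/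
/-- On the increasing region the projection error is at least `a b R² / (a + b)`. -/
lemma projection_error_lower_bound {a b R x y : ℝ} (ha : 0 < a) (hb : 0 < b) (hR : 0 < R)
    (hxy : x ≤ y) : a * b * R ^ 2 / (a + b) ≤ a * (x - R) ^ 2 + b * y ^ 2 := by
  have hc : 0 ≤ 2 * b * (a * R / (a + b)) * (y - x) :=
    mul_nonneg (by positivity) (sub_nonneg.2 hxy)
  have hx : 0 ≤ a * (x - a * R / (a + b)) ^ 2 := by positivity
  have hy : 0 ≤ b * (y - a * R / (a + b)) ^ 2 := by positivity
  have key : a * (x - R) ^ 2 + b * y ^ 2 = a * b * R ^ 2 / (a + b) +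
      2 * b * (a * R / (a + b)) * (y - x) + a * (x - a * R / (a + b)) ^ 2 +
      b * (y - a * R / (a + b)) ^ 2 := by
    field_simp
    ring
  linarith

/-- The value of the projection error at `(R, y, y)` with `y = (R + δ) / (b + 1)`, a point of the
decreasing region, is at most `a b R² / (a + b)`. -/
lemma exists_projection_error_le {a b R δ : ℝ} (ha : 0 < a) (hb : 0 < b) (hR : 0 < R)
    (hδ : 0 < δ) (h : (R + δ) ^ 2 * (a + b) ≤ R ^ 2 * (a * (b + 1))) :
    ∃ y ≤ R, b * y ^ 2 + (y - (R + δ)) ^ 2 ≤ a * b * R ^ 2 / (a + b) := by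
  refine ⟨(R + δ) / (b + 1), ?_, ?_⟩
  · rw [div_le_iff₀ (by positivity)]
    by_contra! hlt
    have hsq : (R * (b + 1)) ^ 2 < (R + δ) ^ 2 := pow_lt_pow_left₀ hlt (by positivity) two_ne_zero
    have hmul := mul_lt_mul_of_pos_right hsq (add_pos ha hb)
    have hpos : 0 < R ^ 2 * ((b + 1) * (a * b + b * (b + 1))) := by positivity
    nlinarith
  · have key : b * ((R + δ) / (b + 1)) ^ 2 + ((R + δ) / (b + 1) - (R + δ)) ^ 2 =
        b * (R + δ) ^ 2 / (b + 1) := by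
      field_simp
      ring
    rw [key, div_le_div_iff₀ (by positivity) (by positivity)]
    nlinarith [mul_le_mul_of_nonneg_left h hb.le]

/-- Core optimization content of Theorem 1 (uniform visitation): for `n`-player
`k`-action matrix games, with `b = Σ_{s=1}^{k−2} C(n+s−1,s)` and `a = kⁿ − (b+1)`,
and `0 < δ ≤ R(√(a(b+1)/(a+b)) − 1)`, the minimum of the projection error `f` over
the monotone-decreasing region is at most its minimum over the monotone-increasing
region. -/
theorem uniform_visitation_suboptimal (n k : ℕ) (hn : 1 ≤ n) (hk : 3 ≤ k)
    (b a R δ : ℝ)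
    (hb : b = ∑ s ∈ Finset.Icc 1 (k - 2), (Nat.choose (n + s - 1) s : ℝ))
    (ha : a = (k : ℝ) ^ n - (b + 1))
    (hR : 0 < R) (hδ : 0 < δ)
    (hδub : δ ≤ R * (Real.sqrt (a * (b + 1) / (a + b)) - 1))
    (f : ℝ × ℝ × ℝ → ℝ)
    (hf : f = fun p => a * (p.1 - R) ^ 2 + b * p.2.1 ^ 2 + (p.2.2 - (R + δ)) ^ 2)
    (M1 M2 : Set (ℝ × ℝ × ℝ))
    (hM1 : M1 = {p : ℝ × ℝ × ℝ | p.2.2 ≤ p.2.1 ∧ p.2.1 ≤ p.1})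
    (hM2 : M2 = {p : ℝ × ℝ × ℝ | p.1 ≤ p.2.1 ∧ p.2.1 ≤ p.2.2}) :
    ∀ V1 V2 : ℝ, IsLeast (f '' M1) V1 → IsLeast (f '' M2) V2 → V1 ≤ V2 := by
  have hb1 : 1 ≤ b := by
    have hmem : 1 ∈ Finset.Icc 1 (k - 2) := Finset.mem_Icc.2 ⟨le_rfl, by omega⟩
    have hle := Finset.single_le_sum
      (f := fun s => (Nat.choose (n + s - 1) s : ℝ)) (fun s _ => Nat.cast_nonneg _) hmem
    have hn' : (1 : ℝ) ≤ n := by exact_mod_cast hn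
    rw [hb]
    simpa using hn'.trans (by simpa using hle)
  have hab : 0 < a + b := by
    have hk' : (1 : ℝ) < k := by exact_mod_cast (by omega : 1 < k)
    have := one_lt_pow₀ hk' (by omega : n ≠ 0)
    linarith
  have hS : 1 < Real.sqrt (a * (b + 1) / (a + b)) := by
    by_contra! h
    nlinarith
  have hS1 : 1 < a * (b + 1) / (a + b) := by
    simpa using (Real.lt_sqrt zero_le_one).1 hS
  have hSsq := Real.sq_sqrt (zero_le_one.trans hS1.le)
  have ha1 : 1 < a := by
    rw [lt_div_iff₀ hab] at hS1
    nlinarith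
  have hkey : (R + δ) ^ 2 * (a + b) ≤ R ^ 2 * (a * (b + 1)) := by
    have h : (R + δ) ^ 2 ≤ (R * Real.sqrt (a * (b + 1) / (a + b))) ^ 2 :=
      pow_le_pow_left₀ (by positivity) (by linarith) 2
    rwa [mul_pow, hSsq, mul_div_assoc', le_div_iff₀ hab] at h
  have ha0 : 0 < a := zero_lt_one.trans ha1
  have hb0 : 0 < b := zero_lt_one.trans_le hb1
  subst hf hM1 hM2
  rintro V1 V2 ⟨-, hV1⟩ ⟨⟨⟨x₁, x₂, x₃⟩, ⟨h12, -⟩, rfl⟩, -⟩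
  obtain ⟨y, hyR, hy⟩ := exists_projection_error_le ha0 hb0 hR hδ hkey
  have hle := hV1 ⟨(R, y, y), ⟨le_rfl, hyR⟩, rfl⟩
  have hlow := projection_error_lower_bound ha0 hb0 hR h12
  dsimp only at hle hlow ⊢
  nlinarith [sq_nonneg (x₃ - (R + δ))]
end

section
/- Let w₁, w₂, w₃, R be positive reals and δ > 0 a real with w₃·δ ≤ w₂·R. Then the minimum of g(x₁,x₂,x₃) = w₁·(x₁ − R)² + w₂·x₂² + w₃·(x₃ − (R+δ))² over the region {(x₁,x₂,x₃) ∈ ℝ³ : x₃ ≤ x₂ ≤ x₁} equals w₂·w₃·(R+δ)²/(w₂+w₃), attained at (R, w₃(R+δ)/(w₂+w₃), w₃(R+δ)/(w₂+w₃)). -/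
/-- Weighted version (ε-greedy visitation): the minimum of
`g(x₁,x₂,x₃) = w₁(x₁−R)² + w₂x₂² + w₃(x₃−(R+δ))²` over the monotone-decreasing
region `{x₃ ≤ x₂ ≤ x₁}` equals `w₂w₃(R+δ)²/(w₂+w₃)`, attained at
`(R, w₃(R+δ)/(w₂+w₃), w₃(R+δ)/(w₂+w₃))`. -/
theorem weighted_M1_min (w₁ w₂ w₃ R δ : ℝ) (hw₁ : 0 < w₁) (hw₂ : 0 < w₂)
    (hw₃ : 0 < w₃) (hR : 0 < R) (hδ : 0 < δ) (hδb : w₃ * δ ≤ w₂ * R)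
    (g : ℝ × ℝ × ℝ → ℝ)
    (hg : g = fun p => w₁ * (p.1 - R) ^ 2 + w₂ * p.2.1 ^ 2 + w₃ * (p.2.2 - (R + δ)) ^ 2)
    (M1 : Set (ℝ × ℝ × ℝ))
    (hM1 : M1 = {p : ℝ × ℝ × ℝ | p.2.2 ≤ p.2.1 ∧ p.2.1 ≤ p.1}) :
    IsLeast (g '' M1) (w₂ * w₃ * (R + δ) ^ 2 / (w₂ + w₃)) ∧
    (R, w₃ * (R + δ) / (w₂ + w₃), w₃ * (R + δ) / (w₂ + w₃)) ∈ M1 ∧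
    g (R, w₃ * (R + δ) / (w₂ + w₃), w₃ * (R + δ) / (w₂ + w₃)) =
      w₂ * w₃ * (R + δ) ^ 2 / (w₂ + w₃) := by
  have hw : 0 < w₂ + w₃ := by positivity
  have hmem : (R, w₃ * (R + δ) / (w₂ + w₃), w₃ * (R + δ) / (w₂ + w₃)) ∈ M1 := by
    rw [hM1]
    refine ⟨le_refl _, ?_⟩
    change w₃ * (R + δ) / (w₂ + w₃) ≤ R
    rw [div_le_iff₀ hw]
    linarith
  have hval : g (R, w₃ * (R + δ) / (w₂ + w₃), w₃ * (R + δ) / (w₂ + w₃)) =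
      w₂ * w₃ * (R + δ) ^ 2 / (w₂ + w₃) := by
    simp only [hg]
    field_simp
    ring
  refine ⟨⟨⟨_, hmem, hval⟩, ?_⟩, hmem, hval⟩
  rintro _ ⟨⟨x, y, z⟩, hp, rfl⟩
  rw [hM1] at hp
  have hzy : z ≤ y := hp.1
  simp only [hg]
  rw [div_le_iff₀ hw]
  have hsq : (R + δ) ^ 2 ≤ (y + (R + δ - z)) ^ 2 :=
    pow_le_pow_left₀ (by positivity) (by linarith) 2
  calc w₂ * w₃ * (R + δ) ^ 2
      ≤ w₂ * w₃ * (y + (R + δ - z)) ^ 2 := by gcongr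
    _ ≤ w₂ * w₃ * (y + (R + δ - z)) ^ 2 + (w₂ * y - w₃ * (R + δ - z)) ^ 2
        + w₁ * (x - R) ^ 2 * (w₂ + w₃) := by
      have : 0 ≤ w₁ * (x - R) ^ 2 * (w₂ + w₃) := by positivity
      linarith [sq_nonneg (w₂ * y - w₃ * (R + δ - z))]
    _ = (w₁ * (x - R) ^ 2 + w₂ * y ^ 2 + w₃ * (z - (R + δ)) ^ 2) * (w₂ + w₃) := by ring
end

section
/- Let w₁, w₂, w₃, R be positive reals and δ > 0 a real. Then the minimum of g(x₁,x₂,x₃) = w₁·(x₁ − R)² + w₂·x₂² + w₃·(x₃ − (R+δ))² over the region {(x₁,x₂,x₃) ∈ ℝ³ : x₁ ≤ x₂ ≤ x₃} equals w₁·w₂·R²/(w₁+w₂), attained at (w₁R/(w₁+w₂), w₁R/(w₁+w₂), R+δ). -/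
/-- Expansion of the two-weight squared error around its minimizer on the diagonal. -/
theorem weighted_sq_sub_add_weighted_sq (w₁ w₂ R a b : ℝ) (h : w₁ + w₂ ≠ 0) :
    w₁ * (a - R) ^ 2 + w₂ * b ^ 2 = w₁ * w₂ * R ^ 2 / (w₁ + w₂) +
      (w₁ * (a - w₁ * R / (w₁ + w₂)) ^ 2 + w₂ * (b - w₁ * R / (w₁ + w₂)) ^ 2 +
        2 * (w₁ * w₂ * R / (w₁ + w₂)) * (b - a)) := by
  field_simp
  ring

/-- Weighted version (ε-greedy visitation): the minimum of
`g(x₁,x₂,x₃) = w₁(x₁−R)² + w₂x₂² + w₃(x₃−(R+δ))²` over the monotone-increasing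
region `{x₁ ≤ x₂ ≤ x₃}` equals `w₁w₂R²/(w₁+w₂)`, attained at
`(w₁R/(w₁+w₂), w₁R/(w₁+w₂), R+δ)`. -/
theorem weighted_M2_min (w₁ w₂ w₃ R δ : ℝ) (hw₁ : 0 < w₁) (hw₂ : 0 < w₂)
    (hw₃ : 0 < w₃) (hR : 0 < R) (hδ : 0 < δ)
    (g : ℝ × ℝ × ℝ → ℝ)
    (hg : g = fun p => w₁ * (p.1 - R) ^ 2 + w₂ * p.2.1 ^ 2 + w₃ * (p.2.2 - (R + δ)) ^ 2)
    (M2 : Set (ℝ × ℝ × ℝ))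
    (hM2 : M2 = {p : ℝ × ℝ × ℝ | p.1 ≤ p.2.1 ∧ p.2.1 ≤ p.2.2}) :
    IsLeast (g '' M2) (w₁ * w₂ * R ^ 2 / (w₁ + w₂)) ∧
    (w₁ * R / (w₁ + w₂), w₁ * R / (w₁ + w₂), R + δ) ∈ M2 ∧
    g (w₁ * R / (w₁ + w₂), w₁ * R / (w₁ + w₂), R + δ) = w₁ * w₂ * R ^ 2 / (w₁ + w₂) := by
  subst hg hM2
  have hs : 0 < w₁ + w₂ := by positivity
  have hmem : (w₁ * R / (w₁ + w₂), w₁ * R / (w₁ + w₂), R + δ) ∈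
      {p : ℝ × ℝ × ℝ | p.1 ≤ p.2.1 ∧ p.2.1 ≤ p.2.2} := by
    refine ⟨le_rfl, ?_⟩
    change w₁ * R / (w₁ + w₂) ≤ R + δ
    rw [div_le_iff₀ hs]
    have : 0 < w₂ * R + δ * (w₁ + w₂) := by positivity
    linarith
  have hval : w₁ * (w₁ * R / (w₁ + w₂) - R) ^ 2 + w₂ * (w₁ * R / (w₁ + w₂)) ^ 2 +
      w₃ * (R + δ - (R + δ)) ^ 2 = w₁ * w₂ * R ^ 2 / (w₁ + w₂) := by
    rw [weighted_sq_sub_add_weighted_sq _ _ _ _ _ hs.ne']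
    ring
  refine ⟨⟨⟨_, hmem, hval⟩, ?_⟩, hmem, hval⟩
  rintro _ ⟨⟨a, b, c⟩, ⟨hab, -⟩, rfl⟩
  have hba : 0 ≤ b - a := sub_nonneg.2 hab
  change _ ≤ w₁ * (a - R) ^ 2 + w₂ * b ^ 2 + w₃ * (c - (R + δ)) ^ 2
  rw [weighted_sq_sub_add_weighted_sq _ _ _ _ _ hs.ne', add_assoc]
  exact le_add_of_nonneg_right (by positivity)
end
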